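/- arXiv:2103.13327 — 5 statements merged into one kernel-verified Lean document; each statement's English description precedes it below -/
import Mathlib

section
/- Let α ∈ ℝ, let Ỹ ∈ ℝ^{n×p} satisfy ỸᵀỸ = I_p, and let η ∈ ℝ^{n×p} be such that A := Ỹᵀη is antisymmetric. Set S₀ := ηᵀη and define, using the matrix exponential, Y(t) := [Ỹ η] · exp( t·[[(2α−1)A, 2(α−1)A² − S₀],[I_p, A]] ) · [exp((1−2α)tA); 0_{p×p}] (here [Ỹ η] ∈ ℝ^{n×2p} is the horizontal concatenation and the last factor is the 2p×p block column). Then Y(0) = Ỹ, Y'(0) = η, Y(t)ᵀY(t) = I_p for all t ∈ ℝ, and Y satisfies the α-geodesic equation. -/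
open Matrix NormedSpace
attribute [local instance] Matrix.normedAddCommGroup Matrix.normedSpace

/-- A twice-differentiable curve `Y : ℝ → ℝ^{n×p}` satisfies the α-geodesic equation if
`Y'' + Y (Y'ᵀ Y') + 2(1−α)(I − Y Yᵀ)(Y' Y'ᵀ) Y = 0`. -/
def IsAlphaGeodesic {n p : ℕ} (α : ℝ) (Y : ℝ → Matrix (Fin n) (Fin p) ℝ) : Prop :=
  (∀ t, DifferentiableAt ℝ Y t) ∧ (∀ t, DifferentiableAt ℝ (deriv Y) t) ∧
  ∀ t : ℝ, deriv (deriv Y) t + Y t * ((deriv Y t)ᵀ * deriv Y t)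
    + (2 * (1 - α)) • (((1 : Matrix (Fin n) (Fin n) ℝ) - Y t * (Y t)ᵀ)
        * (deriv Y t * (deriv Y t)ᵀ) * Y t) = 0

theorem HasDerivAt.matrix_mul {l m n : Type*} [Fintype l] [Fintype m] [Fintype n]
    {F : ℝ → Matrix l m ℝ} {G : ℝ → Matrix m n ℝ} {F' : Matrix l m ℝ} {G' : Matrix m n ℝ} {t : ℝ}
    (hF : HasDerivAt F F' t) (hG : HasDerivAt G G' t) :
    HasDerivAt (fun s => F s * G s) (F' * G t + F t * G') t := by
  refine hasDerivAt_pi.2 fun i => hasDerivAt_pi.2 fun j => ?_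
  have h := HasDerivAt.fun_sum (u := Finset.univ) fun k _ =>
    (hasDerivAt_pi.1 (hasDerivAt_pi.1 hF i) k).mul (hasDerivAt_pi.1 (hasDerivAt_pi.1 hG k) j)
  simpa [Matrix.mul_apply, Finset.sum_add_distrib] using h

theorem HasDerivAt.matrix_transpose {l m : Type*} [Fintype l] [Fintype m]
    {F : ℝ → Matrix l m ℝ} {F' : Matrix l m ℝ} {t : ℝ} (hF : HasDerivAt F F' t) :
    HasDerivAt (fun s => (F s)ᵀ) F'ᵀ t :=
  hasDerivAt_pi.2 fun i => hasDerivAt_pi.2 fun j => hasDerivAt_pi.1 (hasDerivAt_pi.1 hF j) i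

theorem hasDerivAt_exp_smul_of_finiteDimensional {𝔸 : Type*} [NormedRing 𝔸] [NormedAlgebra ℝ 𝔸]
    [FiniteDimensional ℝ 𝔸] (x : 𝔸) (t : ℝ) :
    HasDerivAt (fun s : ℝ => exp (s • x)) (exp (t • x) * x) t :=
  have : CompleteSpace 𝔸 := FiniteDimensional.complete ℝ 𝔸
  hasDerivAt_exp_smul_const x t

theorem Matrix.hasDerivAt_exp_smul {m : Type*} [Fintype m] [DecidableEq m]
    (X : Matrix m m ℝ) (t : ℝ) :
    HasDerivAt (fun s : ℝ => exp (s • X)) (exp (t • X) * X) t := by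
  let _ : NormedRing (Matrix m m ℝ) := Matrix.linftyOpNormedRing
  let _ : NormedAlgebra ℝ (Matrix m m ℝ) := Matrix.linftyOpNormedAlgebra
  exact hasDerivAt_exp_smul_of_finiteDimensional X t

theorem Matrix.eq_of_hasDerivAt_zero {l m : Type*} [Fintype l] [Fintype m]
    {F : ℝ → Matrix l m ℝ} (hF : ∀ t, HasDerivAt F 0 t) (s t : ℝ) : F s = F t := by
  ext i j
  have h : ∀ u, HasDerivAt (fun u => F u i j) 0 u := fun u =>
    hasDerivAt_pi.1 (hasDerivAt_pi.1 (hF u) i) j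
  exact is_const_of_deriv_eq_zero (fun u => (h u).differentiableAt) (fun u => (h u).deriv) s t

/-- The flow of an infinitesimal isometry of the bilinear form `G` preserves `G`. -/
theorem Matrix.transpose_exp_smul_mul_mul_exp_smul {m : Type*} [Fintype m] [DecidableEq m]
    {X G : Matrix m m ℝ} (h : Xᵀ * G + G * X = 0) (t : ℝ) :
    (exp (t • X))ᵀ * G * exp (t • X) = G := by
  have hd : ∀ t : ℝ, HasDerivAt (fun s : ℝ => (exp (s • X))ᵀ * G * exp (s • X)) 0 t := by
    intro t
    have hX := hasDerivAt_exp_smul X t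
    have hX' : HasDerivAt (fun s : ℝ => exp (s • X)) (X * exp (t • X)) t := by
      have hc : Commute (t • X) X := (Commute.refl X).smul_left t
      rwa [hc.exp_left.eq] at hX
    have := (hX'.matrix_transpose.matrix_mul (hasDerivAt_const t G)).matrix_mul hX'
    convert this using 1
    calc (0 : Matrix m m ℝ) = (exp (t • X))ᵀ * (Xᵀ * G + G * X) * exp (t • X) := by simp [h]
      _ = _ := by simp only [transpose_mul]; noncomm_ring
  have := eq_of_hasDerivAt_zero hd t 0
  simpa using this

/-- The generator of the geodesic flow is an infinitesimal isometry of the Gram matrix of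
`[Ỹ η]`. -/
theorem transpose_fromBlocks_mul_gram_add {m : Type*} [Fintype m] [DecidableEq m] (α : ℝ)
    {A S : Matrix m m ℝ} (hA : Aᵀ = -A) (hS : Sᵀ = S) :
    (fromBlocks ((2 * α - 1) • A) ((2 * (α - 1)) • A ^ 2 - S) 1 A)ᵀ * fromBlocks 1 A (-A) S
      + fromBlocks 1 A (-A) S
        * fromBlocks ((2 * α - 1) • A) ((2 * (α - 1)) • A ^ 2 - S) 1 A = 0 := by
  rw [fromBlocks_transpose, fromBlocks_multiply, fromBlocks_multiply, fromBlocks_add,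
    ← fromBlocks_zero]
  simp only [transpose_smul, transpose_sub, transpose_mul, hA, hS, transpose_one,
    Matrix.one_mul, Matrix.mul_one, Matrix.neg_mul, Matrix.mul_neg, Matrix.mul_sub,
    Matrix.sub_mul, Matrix.smul_mul, Matrix.mul_smul, pow_two, Matrix.mul_assoc]
  congr 1 <;> module

/-- A curve `P R` is an `α`-geodesic on the Stiefel manifold whenever `P`, `Q` solve the linear
system below with constant Gram matrices and `R` is the orthogonal flow of `(1 - 2α) A`. -/
theorem isAlphaGeodesic_mul {n p : ℕ} {α : ℝ} {A S : Matrix (Fin p) (Fin p) ℝ}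
    {P Q : ℝ → Matrix (Fin n) (Fin p) ℝ} {R : ℝ → Matrix (Fin p) (Fin p) ℝ}
    (hA : Aᵀ = -A)
    (hP : ∀ t, HasDerivAt P (P t * ((2 * α - 1) • A) + Q t) t)
    (hQ : ∀ t, HasDerivAt Q (P t * ((2 * (α - 1)) • A ^ 2 - S) + Q t * A) t)
    (hR : ∀ t, HasDerivAt R (((1 - 2 * α) • A) * R t) t)
    (hPQ : ∀ t, (P t)ᵀ * Q t = A) (hQQ : ∀ t, (Q t)ᵀ * Q t = S)
    (hRR : ∀ t, R t * (R t)ᵀ = 1) :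
    (∀ t, HasDerivAt (fun s => P s * R s) (Q t * R t) t) ∧
      IsAlphaGeodesic α (fun s => P s * R s) := by
  have h1 : ∀ t, HasDerivAt (fun s => P s * R s) (Q t * R t) t := by
    intro t
    convert (hP t).matrix_mul (hR t) using 1
    have : (1 - 2 * α) • A = -((2 * α - 1) • A) := by rw [← neg_smul]; congr 1; ring
    rw [this]
    simp only [neg_mul, Matrix.add_mul, Matrix.mul_neg, Matrix.mul_assoc]
    abel
  have h2 : ∀ t, HasDerivAt (fun s => Q s * R s)
      ((P t * ((2 * (α - 1)) • A ^ 2 - S) + Q t * A) * R t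
        + Q t * (((1 - 2 * α) • A) * R t)) t := fun t => (hQ t).matrix_mul (hR t)
  have hd : deriv (fun s => P s * R s) = fun s => Q s * R s := funext fun t => (h1 t).deriv
  refine ⟨h1, fun t => (h1 t).differentiableAt, ?_, ?_⟩
  · rw [hd]
    exact fun t => (h2 t).differentiableAt
  · intro t
    have hdd : deriv (fun s => Q s * R s) t = _ := (h2 t).deriv
    rw [hd, hdd]
    beta_reduce
    have e1 : P t * R t * ((Q t * R t)ᵀ * (Q t * R t)) = P t * S * R t := by
      calc _ = P t * (R t * (R t)ᵀ) * ((Q t)ᵀ * Q t) * R t := by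
            simp only [transpose_mul, Matrix.mul_assoc]
        _ = _ := by rw [hRR, hQQ, Matrix.mul_one]
    have hQP : (Q t)ᵀ * P t = -A := by
      rw [← hA, ← hPQ t, transpose_mul, transpose_transpose]
    have e2 : Q t * R t * (Q t * R t)ᵀ * (P t * R t) = -(Q t * A * R t) := by
      calc _ = Q t * (R t * (R t)ᵀ) * ((Q t)ᵀ * P t) * R t := by
            simp only [transpose_mul, Matrix.mul_assoc]
        _ = _ := by rw [hRR, hQP]; simp
    have e3 : P t * R t * (P t * R t)ᵀ * (Q t * A * R t) = P t * A ^ 2 * R t := by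
      calc _ = P t * (R t * (R t)ᵀ) * ((P t)ᵀ * Q t) * A * R t := by
            simp only [transpose_mul, Matrix.mul_assoc]
        _ = _ := by rw [hRR, hPQ, pow_two]; simp only [Matrix.mul_one, Matrix.mul_assoc]
    rw [Matrix.mul_assoc (1 - _), e1, e2, Matrix.sub_mul, Matrix.mul_neg, Matrix.mul_neg, e3]
    simp only [Matrix.mul_sub, Matrix.sub_mul, Matrix.add_mul, Matrix.one_mul, Matrix.smul_mul,
      Matrix.mul_smul, Matrix.mul_assoc]
    module

/-- Geodesic formula (13) of the paper: with `A = Ỹᵀη` antisymmetric and `S₀ = ηᵀη`,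
`Y(t) = [Ỹ η] exp(t [[(2α−1)A, 2(α−1)A²−S₀],[I, A]]) [exp((1−2α)tA); 0]` is the geodesic with
`Y(0) = Ỹ`, `Y'(0) = η`, staying on the Stiefel manifold and solving the α-geodesic equation. -/
theorem stiefel_geodesic_formula_one {n p : ℕ} (α : ℝ)
    (Ytilde η : Matrix (Fin n) (Fin p) ℝ)
    (hY : Ytildeᵀ * Ytilde = 1)
    (hA : (Ytildeᵀ * η)ᵀ + Ytildeᵀ * η = 0) :
    let A : Matrix (Fin p) (Fin p) ℝ := Ytildeᵀ * η
    let S₀ : Matrix (Fin p) (Fin p) ℝ := ηᵀ * η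
    let Y : ℝ → Matrix (Fin n) (Fin p) ℝ := fun t =>
      fromCols Ytilde η *
        exp (t • fromBlocks ((2 * α - 1) • A) ((2 * (α - 1)) • A ^ 2 - S₀)
          (1 : Matrix (Fin p) (Fin p) ℝ) A) *
        fromRows (exp (((1 - 2 * α) * t) • A)) (0 : Matrix (Fin p) (Fin p) ℝ)
    Y 0 = Ytilde ∧ deriv Y 0 = η ∧ (∀ t : ℝ, (Y t)ᵀ * Y t = 1) ∧ IsAlphaGeodesic α Y := by
  intro A S₀ Y
  have hAt : Aᵀ = -A := eq_neg_of_add_eq_zero_left hA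
  have hηY : ηᵀ * Ytilde = -A := by rw [← hAt, transpose_mul, transpose_transpose]
  have hSt : S₀ᵀ = S₀ := by simp [S₀, transpose_mul]
  set M := fromBlocks ((2 * α - 1) • A) ((2 * (α - 1)) • A ^ 2 - S₀)
    (1 : Matrix (Fin p) (Fin p) ℝ) A with hM
  let W : ℝ → Matrix (Fin n) (Fin p ⊕ Fin p) ℝ := fun t => fromCols Ytilde η * exp (t • M)
  let P : ℝ → Matrix (Fin n) (Fin p) ℝ := fun t => (W t).toCols₁
  let Q : ℝ → Matrix (Fin n) (Fin p) ℝ := fun t => (W t).toCols₂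
  let R : ℝ → Matrix (Fin p) (Fin p) ℝ := fun t => exp (t • ((1 - 2 * α) • A))
  have hWPQ : ∀ t, W t = fromCols (P t) (Q t) := fun t => (fromCols_toCols (W t)).symm
  have hW0 : W 0 = fromCols Ytilde η := by simp [W]
  have hP0 : P 0 = Ytilde := by simp [P, hW0]
  have hQ0 : Q 0 = η := by simp [Q, hW0]
  have hR0 : R 0 = 1 := by simp [R]
  have hYPR : Y = fun t => P t * R t := by
    funext t
    change W t * fromRows (exp (((1 - 2 * α) * t) • A)) (0 : Matrix (Fin p) (Fin p) ℝ) = _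
    rw [hWPQ, fromCols_mul_fromRows, Matrix.mul_zero, add_zero, mul_comm (1 - 2 * α) t, mul_smul]
  have hWd : ∀ t, HasDerivAt W (fromCols (P t * ((2 * α - 1) • A) + Q t)
      (P t * ((2 * (α - 1)) • A ^ 2 - S₀) + Q t * A)) t := by
    intro t
    convert (hasDerivAt_const t (fromCols Ytilde η)).matrix_mul (hasDerivAt_exp_smul M t) using 1
    rw [Matrix.zero_mul, zero_add, ← Matrix.mul_assoc (fromCols Ytilde η)]
    change _ = W t * M
    rw [hWPQ, hM, fromCols_mul_fromBlocks, Matrix.mul_one]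
  have hPd : ∀ t, HasDerivAt P (P t * ((2 * α - 1) • A) + Q t) t := fun t =>
    hasDerivAt_pi.2 fun i => hasDerivAt_pi.2 fun j =>
      hasDerivAt_pi.1 (hasDerivAt_pi.1 (hWd t) i) (Sum.inl j)
  have hQd : ∀ t, HasDerivAt Q (P t * ((2 * (α - 1)) • A ^ 2 - S₀) + Q t * A) t := fun t =>
    hasDerivAt_pi.2 fun i => hasDerivAt_pi.2 fun j =>
      hasDerivAt_pi.1 (hasDerivAt_pi.1 (hWd t) i) (Sum.inr j)
  have hRd : ∀ t, HasDerivAt R (((1 - 2 * α) • A) * R t) t := by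
    intro t
    have hc : Commute (t • ((1 - 2 * α) • A)) ((1 - 2 * α) • A) := (Commute.refl _).smul_left t
    rw [← hc.exp_left.eq]
    exact hasDerivAt_exp_smul _ t
  have hRR : ∀ t, (R t)ᵀ * R t = 1 := by
    intro t
    have := transpose_exp_smul_mul_mul_exp_smul (X := (1 - 2 * α) • A) (G := 1)
      (by simp [hAt]) t
    rwa [Matrix.mul_one] at this
  have hG : ∀ t, fromBlocks ((P t)ᵀ * P t) ((P t)ᵀ * Q t) ((Q t)ᵀ * P t) ((Q t)ᵀ * Q t)
      = fromBlocks 1 A (-A) S₀ := by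
    intro t
    have h := transpose_exp_smul_mul_mul_exp_smul (transpose_fromBlocks_mul_gram_add α hAt hSt) t
    have h0 : (fromCols Ytilde η)ᵀ * fromCols Ytilde η = fromBlocks 1 A (-A) S₀ := by
      rw [transpose_fromCols, fromRows_mul_fromCols, hY, hηY]
    rw [← fromRows_mul_fromCols, ← transpose_fromCols, ← hWPQ, ← h, ← h0]
    simp only [W, hM, transpose_mul, Matrix.mul_assoc]
  have hPP : ∀ t, (P t)ᵀ * P t = 1 := fun t => (fromBlocks_inj.1 (hG t)).1
  have hPQ : ∀ t, (P t)ᵀ * Q t = A := fun t => (fromBlocks_inj.1 (hG t)).2.1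
  have hQQ : ∀ t, (Q t)ᵀ * Q t = S₀ := fun t => (fromBlocks_inj.1 (hG t)).2.2.2
  obtain ⟨hYd, hgeo⟩ := isAlphaGeodesic_mul hAt hPd hQd hRd hPQ hQQ
    fun t => mul_eq_one_comm.1 (hRR t)
  rw [hYPR]
  refine ⟨by simp [hP0, hR0], (hYd 0).deriv.trans (by rw [hQ0, hR0, Matrix.mul_one]), fun t => ?_, hgeo⟩
  calc (P t * R t)ᵀ * (P t * R t) = (R t)ᵀ * ((P t)ᵀ * P t) * R t := by
        simp only [transpose_mul, Matrix.mul_assoc]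
    _ = 1 := by rw [hPP, Matrix.mul_one, hRR]
end

section
/- Let α ∈ ℝ, let Ỹ ∈ ℝ^{n×p} and Q ∈ ℝ^{n×k} satisfy ỸᵀỸ = I_p, QᵀQ = I_k, ỸᵀQ = 0, and let Z ∈ ℝ^{n×p} satisfy ZᵀZ = I_p. For an antisymmetric A ∈ ℝ^{p×p} and R ∈ ℝ^{k×p}, set Â := [[2αA, −Rᵀ],[R, 0]] ∈ ℝ^{(p+k)×(p+k)}, P := [I_p; 0_{k×p}] ∈ ℝ^{(p+k)×p}, and F(A,R) := −Tr( Zᵀ·[Ỹ Q]·exp(Â)·P·exp((1−2α)A) ). Fix an antisymmetric ΔA ∈ ℝ^{p×p} and ΔR ∈ ℝ^{k×p}, and set ΔÂ := [[2αΔA, −ΔRᵀ],[ΔR, 0]], L̂ := L_exp(Â, P·exp((1−2α)A)·Zᵀ·[Ỹ Q]), and L̊ := L_exp((1−2α)A, Zᵀ·[Ỹ Q]·exp(Â)·P). Then the function s ↦ F(A + sΔA, R + sΔR) is differentiable at s = 0 with derivative equal to −Tr(L̂·ΔÂ) − (1−2α)·Tr(L̊·ΔA). -/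
open Matrix NormedSpace

/-- The Fréchet derivative of the matrix exponential:
`L_exp(A, E) = ∑_{i≥1} (1/i!) ∑_{a+b=i−1} A^a E A^b`. -/
noncomputable def Lexp {ι : Type*} [Fintype ι] [DecidableEq ι]
    (A E : Matrix ι ι ℝ) : Matrix ι ι ℝ :=
  ∑' i : ℕ, ((Nat.factorial (i + 1) : ℝ))⁻¹ •
    ∑ a ∈ Finset.range (i + 1), A ^ a * E * A ^ (i - a)

section NormedAlgebra
variable {𝔸 : Type*} [NormedRing 𝔸]

theorem norm_pow_mul_mul_pow_le (X E : 𝔸) (a b : ℕ) :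
    ‖X ^ a * E * X ^ b‖ ≤ ‖X‖ ^ (a + b) * ‖E‖ := by
  induction b with
  | zero =>
    induction a with
    | zero => simp
    | succ a ih =>
      calc ‖X ^ (a + 1) * E * X ^ 0‖ = ‖X * (X ^ a * E * X ^ 0)‖ := by
            simp only [pow_succ', mul_assoc]
        _ ≤ ‖X‖ * (‖X‖ ^ (a + 0) * ‖E‖) := (norm_mul_le _ _).trans (by gcongr)
        _ = ‖X‖ ^ (a + 1 + 0) * ‖E‖ := by ring
  | succ b ih =>
    calc ‖X ^ a * E * X ^ (b + 1)‖ = ‖X ^ a * E * X ^ b * X‖ := by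
          simp only [pow_succ, mul_assoc]
      _ ≤ ‖X‖ ^ (a + b) * ‖E‖ * ‖X‖ := (norm_mul_le _ _).trans (by gcongr)
      _ = ‖X‖ ^ (a + (b + 1)) * ‖E‖ := by ring

variable [NormedAlgebra ℝ 𝔸]

theorem norm_inv_factorial_smul_sum_pow_mul_mul_pow_le (X E : 𝔸) (i : ℕ) :
    ‖((Nat.factorial (i + 1) : ℝ))⁻¹ • ∑ a ∈ Finset.range (i + 1), X ^ a * E * X ^ (i - a)‖
      ≤ ‖X‖ ^ i / Nat.factorial i * ‖E‖ := by
  have hsum : ‖∑ a ∈ Finset.range (i + 1), X ^ a * E * X ^ (i - a)‖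
      ≤ (i + 1) * (‖X‖ ^ i * ‖E‖) := by
    refine (norm_sum_le_of_le _ (n := fun _ => ‖X‖ ^ i * ‖E‖) fun a ha => ?_).trans_eq (by simp)
    have h := norm_pow_mul_mul_pow_le X E a (i - a)
    rwa [Nat.add_sub_cancel' (Finset.mem_range_succ_iff.mp ha)] at h
  rw [norm_smul, norm_inv, Real.norm_natCast]
  calc _ ≤ ((Nat.factorial (i + 1) : ℝ))⁻¹ * ((i + 1) * (‖X‖ ^ i * ‖E‖)) := by gcongr
    _ = _ := by
      rw [Nat.factorial_succ]
      push_cast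
      field_simp

theorem hasDerivAt_add_smul_pow_succ (X E : 𝔸) (i : ℕ) (s : ℝ) :
    HasDerivAt (fun t : ℝ => (X + t • E) ^ (i + 1))
      (∑ a ∈ Finset.range (i + 1), (X + s • E) ^ a * E * (X + s • E) ^ (i - a)) s := by
  have h : HasDerivAt (fun t : ℝ => X + t • E) E s := by
    simpa using ((hasDerivAt_id s).smul_const E).const_add X
  convert! h.fun_pow' (i + 1) using 1
  rw [← Finset.sum_range_reflect]
  refine Finset.sum_congr rfl fun a ha => ?_
  rw [Nat.pred_succ, Nat.add_sub_cancel, Nat.sub_sub_self (Finset.mem_range_succ_iff.mp ha)]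

variable [CompleteSpace 𝔸]

theorem summable_inv_factorial_smul_sum_pow_mul_mul_pow (X E : 𝔸) :
    Summable fun i : ℕ => ((Nat.factorial (i + 1) : ℝ))⁻¹ •
      ∑ a ∈ Finset.range (i + 1), X ^ a * E * X ^ (i - a) :=
  .of_norm_bounded ((Real.summable_pow_div_factorial ‖X‖).mul_right ‖E‖)
    (norm_inv_factorial_smul_sum_pow_mul_mul_pow_le X E)

theorem hasDerivAt_exp_add_smul (X E : 𝔸) :
    HasDerivAt (fun s : ℝ => exp (X + s • E))
      (∑' i : ℕ, ((Nat.factorial (i + 1) : ℝ))⁻¹ •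
        ∑ a ∈ Finset.range (i + 1), X ^ a * E * X ^ (i - a)) 0 := by
  have hexp (Y : 𝔸) : exp Y = 1 + ∑' i : ℕ, ((Nat.factorial (i + 1) : ℝ))⁻¹ • Y ^ (i + 1) := by
    rw [congrFun (exp_eq_tsum ℝ) Y, (expSeries_summable' (𝕂 := ℝ) Y).tsum_eq_zero_add]
    simp
  simp only [hexp]
  have h := hasDerivAt_tsum_of_isPreconnected
    (g := fun (i : ℕ) (s : ℝ) => ((Nat.factorial (i + 1) : ℝ))⁻¹ • (X + s • E) ^ (i + 1))
    (g' := fun (i : ℕ) (s : ℝ) => ((Nat.factorial (i + 1) : ℝ))⁻¹ •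
      ∑ a ∈ Finset.range (i + 1), (X + s • E) ^ a * E * (X + s • E) ^ (i - a))
    (y := 0) (y₀ := 0)
    ((Real.summable_pow_div_factorial (‖X‖ + ‖E‖)).mul_right ‖E‖) Metric.isOpen_ball
    (convex_ball (0 : ℝ) 1).isPreconnected
    (fun i s _ => (hasDerivAt_add_smul_pow_succ X E i s).fun_const_smul _)
    (fun i s hs => (norm_inv_factorial_smul_sum_pow_mul_mul_pow_le _ E i).trans ?_)
    (Metric.mem_ball_self one_pos)
    ((summable_nat_add_iff 1).mpr (expSeries_summable' (𝕂 := ℝ) (X + (0 : ℝ) • E)))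
    (Metric.mem_ball_self one_pos)
  · simpa using h.const_add 1
  · have hX : ‖X + s • E‖ ≤ ‖X‖ + ‖E‖ := by
      refine (norm_add_le _ _).trans ?_
      rw [norm_smul]
      gcongr
      exact mul_le_of_le_one_left (norm_nonneg _) (mem_ball_zero_iff.mp hs).le
    gcongr

end NormedAlgebra

section Matrix
open scoped Matrix.Norms.Operator

variable {ι : Type*} [Fintype ι] [DecidableEq ι]

theorem hasDerivAt_exp_add_smul_matrix (X E : Matrix ι ι ℝ) :
    HasDerivAt (fun s : ℝ => exp (X + s • E)) (Lexp X E) 0 :=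
  hasDerivAt_exp_add_smul X E

theorem trace_Lexp_mul (X E D : Matrix ι ι ℝ) :
    trace (Lexp X E * D) = ∑' i : ℕ, ((Nat.factorial (i + 1) : ℝ))⁻¹ *
      ∑ a ∈ Finset.range (i + 1), trace (X ^ a * E * X ^ (i - a) * D) := by
  let φ : Matrix ι ι ℝ →ₗ[ℝ] ℝ := traceLinearMap ι ℝ ℝ ∘ₗ LinearMap.mulRight ℝ D
  have h := (LinearMap.toContinuousLinearMap φ).map_tsum
    (summable_inv_factorial_smul_sum_pow_mul_mul_pow X E)
  simpa [φ, Lexp, Finset.sum_mul, trace_sum] using h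

theorem trace_Lexp_mul_comm (X E D : Matrix ι ι ℝ) :
    trace (Lexp X E * D) = trace (Lexp X D * E) := by
  simp only [trace_Lexp_mul]
  refine tsum_congr fun i => congrArg _ ?_
  rw [← Finset.sum_range_reflect]
  refine Finset.sum_congr rfl fun a ha => ?_
  have ha := Finset.mem_range_succ_iff.mp ha
  rw [show i + 1 - 1 - a = i - a by lia, Nat.sub_sub_self ha, Matrix.mul_assoc,
    Matrix.trace_mul_comm]
  simp only [Matrix.mul_assoc]

/-- The derivative of `s ↦ Tr(M exp(X + sE) N exp(W + sG))` at `0`. -/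
theorem hasDerivAt_trace_mul_exp_mul_mul_exp {κ : Type*} [Fintype κ] [DecidableEq κ]
    (M : Matrix κ ι ℝ) (N : Matrix ι κ ℝ) (X E : Matrix ι ι ℝ) (W G : Matrix κ κ ℝ) :
    HasDerivAt (fun s : ℝ => trace (M * exp (X + s • E) * N * exp (W + s • G)))
      (trace (Lexp X (N * exp W * M) * E) + trace (Lexp W (M * exp X * N) * G)) 0 := by
  let φ : Matrix ι ι ℝ →ₗ[ℝ] Matrix κ κ ℝ :=
    mulRightLinearMap κ ℝ N ∘ₗ mulLeftLinearMap ι ℝ M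
  let τ : Matrix κ κ ℝ →ₗ[ℝ] ℝ := traceLinearMap κ ℝ ℝ
  have hX := (LinearMap.toContinuousLinearMap φ).hasFDerivAt.comp_hasDerivAt 0
    (hasDerivAt_exp_add_smul_matrix X E)
  have h := (LinearMap.toContinuousLinearMap τ).hasFDerivAt.comp_hasDerivAt 0
    (hX.mul (hasDerivAt_exp_add_smul_matrix W G))
  refine h.congr_deriv ?_
  change trace (M * Lexp X E * N * exp (W + (0 : ℝ) • G) +
    M * exp (X + (0 : ℝ) • E) * N * Lexp W G) = _
  rw [zero_smul, zero_smul, add_zero, add_zero, trace_add, trace_Lexp_mul_comm X,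
    trace_Lexp_mul_comm W, Matrix.trace_mul_comm (Lexp W G), Matrix.mul_assoc (M * _),
    Matrix.mul_assoc M, Matrix.trace_mul_comm M, Matrix.mul_assoc (Lexp X E)]

end Matrix

/-- Gradient of the Stiefel log objective `F(A,R) = −Tr(Zᵀ[Ỹ Q]exp(Â)P exp((1−2α)A))`:
the directional derivative of `F` at `(A,R)` along `(ΔA,ΔR)` equals
`−Tr(L̂ ΔÂ) − (1−2α)Tr(L̊ ΔA)` where `L̂, L̊` are the indicated Fréchet derivatives. -/
theorem stiefel_objective_gradient {n p k : ℕ} (α : ℝ)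
    (Ytilde Z : Matrix (Fin n) (Fin p) ℝ) (Q : Matrix (Fin n) (Fin k) ℝ)
    (hY : Ytildeᵀ * Ytilde = 1) (hQ : Qᵀ * Q = 1) (hYQ : Ytildeᵀ * Q = 0)
    (hZ : Zᵀ * Z = 1)
    (A ΔA : Matrix (Fin p) (Fin p) ℝ) (R ΔR : Matrix (Fin k) (Fin p) ℝ)
    (hA : Aᵀ + A = 0) (hΔA : ΔAᵀ + ΔA = 0) :
    let hat : Matrix (Fin p) (Fin p) ℝ → Matrix (Fin k) (Fin p) ℝ →
        Matrix (Fin p ⊕ Fin k) (Fin p ⊕ Fin k) ℝ :=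
      fun B S => fromBlocks ((2 * α) • B) (-Sᵀ) S 0
    let P : Matrix (Fin p ⊕ Fin k) (Fin p) ℝ :=
      fromRows (1 : Matrix (Fin p) (Fin p) ℝ) (0 : Matrix (Fin k) (Fin p) ℝ)
    let K : Matrix (Fin n) (Fin p ⊕ Fin k) ℝ := fromCols Ytilde Q
    let F : Matrix (Fin p) (Fin p) ℝ → Matrix (Fin k) (Fin p) ℝ → ℝ :=
      fun B S => -Matrix.trace (Zᵀ * K * exp (hat B S) * P * exp ((1 - 2 * α) • B))
    let Lhat : Matrix (Fin p ⊕ Fin k) (Fin p ⊕ Fin k) ℝ :=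
      Lexp (hat A R) (P * exp ((1 - 2 * α) • A) * (Zᵀ * K))
    let Lring : Matrix (Fin p) (Fin p) ℝ :=
      Lexp ((1 - 2 * α) • A) (Zᵀ * K * exp (hat A R) * P)
    HasDerivAt (fun s : ℝ => F (A + s • ΔA) (R + s • ΔR))
      (-Matrix.trace (Lhat * hat ΔA ΔR) - (1 - 2 * α) * Matrix.trace (Lring * ΔA)) 0 := by
  intro hat P K F Lhat Lring
  have hhat (s : ℝ) : hat (A + s • ΔA) (R + s • ΔR) = hat A R + s • hat ΔA ΔR := by
    simp only [hat, fromBlocks_smul, fromBlocks_add, smul_add, transpose_add, transpose_smul,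
      neg_add, smul_neg, smul_zero, add_zero, smul_comm s]
  have h := (hasDerivAt_trace_mul_exp_mul_mul_exp (Zᵀ * K) P (hat A R) (hat ΔA ΔR)
    ((1 - 2 * α) • A) ((1 - 2 * α) • ΔA)).neg
  convert! h using 1
  · funext s
    simp only [F, hhat, smul_add, smul_comm s, Pi.neg_apply]
  · simp only [Lhat, Lring, mul_smul_comm, trace_smul, smul_eq_mul]
    ring
end

section
/- Let α ∈ ℝ, let Ỹ ∈ ℝ^{n×p} satisfy ỸᵀỸ = I_p, and let A ∈ ℝ^{p×p} be antisymmetric. Then the curve Y(t) := Ỹ·exp(tA) satisfies Y(t)ᵀY(t) = I_p for all t and satisfies the α-geodesic equation (for every value of α); moreover Y(0) = Ỹ and Y'(0) = Ỹ·A. -/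
open Matrix NormedSpace
attribute [local instance] Matrix.normedAddCommGroup Matrix.normedSpace

theorem hasDerivAt_matrix_exp_smul {p : ℕ} (A : Matrix (Fin p) (Fin p) ℝ) (t : ℝ) :
    HasDerivAt (fun s : ℝ => exp (s • A)) (exp (t • A) * A) t := by
  let _ : NormedRing (Matrix (Fin p) (Fin p) ℝ) := Matrix.linftyOpNormedRing
  let _ : NormedAlgebra ℝ (Matrix (Fin p) (Fin p) ℝ) := Matrix.linftyOpNormedAlgebra
  have : @CompleteSpace _
      (Matrix.linftyOpNormedRing (n := Fin p) (α := ℝ)).toMetricSpace.toUniformSpace :=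
    inferInstanceAs (CompleteSpace (Matrix (Fin p) (Fin p) ℝ))
  exact hasDerivAt_exp_smul_const A t

theorem hasDerivAt_mul_matrix_exp_smul {n p : ℕ} (M : Matrix (Fin n) (Fin p) ℝ)
    (A : Matrix (Fin p) (Fin p) ℝ) (t : ℝ) :
    HasDerivAt (fun s : ℝ => M * exp (s • A)) (M * exp (t • A) * A) t := by
  rw [Matrix.mul_assoc]
  exact (LinearMap.toContinuousLinearMap
    (mulLeftLinearMap (Fin p) ℝ M)).hasFDerivAt.comp_hasDerivAt t (hasDerivAt_matrix_exp_smul A t)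

theorem matrix_exp_smul_mul_comm {p : ℕ} (A : Matrix (Fin p) (Fin p) ℝ) (t : ℝ) :
    exp (t • A) * A = A * exp (t • A) :=
  (((Commute.refl A).smul_left t).exp_left).eq

theorem transpose_exp_smul_mul_exp_smul {p : ℕ} {A : Matrix (Fin p) (Fin p) ℝ}
    (hA : Aᵀ + A = 0) (t : ℝ) : (exp (t • A))ᵀ * exp (t • A) = 1 := by
  rw [← Matrix.exp_transpose, transpose_smul, eq_neg_of_add_eq_zero_left hA, smul_neg,
    ← Matrix.exp_add_of_commute _ _ (Commute.refl (t • A)).neg_left, neg_add_cancel, exp_zero]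

/-- For antisymmetric `A`, the curve `Y(t) = Ỹ exp(tA)` stays on the Stiefel manifold,
satisfies the α-geodesic equation for every α, and has `Y(0) = Ỹ`, `Y'(0) = ỸA`. -/
theorem stiefel_closed_geodesic_vertical {n p : ℕ} (α : ℝ)
    (Ytilde : Matrix (Fin n) (Fin p) ℝ) (A : Matrix (Fin p) (Fin p) ℝ)
    (hY : Ytildeᵀ * Ytilde = 1) (hA : Aᵀ + A = 0) :
    let Y : ℝ → Matrix (Fin n) (Fin p) ℝ := fun t => Ytilde * exp (t • A)
    (∀ t : ℝ, (Y t)ᵀ * Y t = 1) ∧ IsAlphaGeodesic α Y ∧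
    Y 0 = Ytilde ∧ deriv Y 0 = Ytilde * A := by
  intro Y
  have hYY (t : ℝ) : (Y t)ᵀ * Y t = 1 := by
    simp only [Y]
    rw [transpose_mul, Matrix.mul_assoc, ← Matrix.mul_assoc Ytildeᵀ, hY, Matrix.one_mul,
      transpose_exp_smul_mul_exp_smul hA]
  have hY0 : Y 0 = Ytilde := by simp [Y]
  have hd (t : ℝ) : HasDerivAt Y (Y t * A) t := hasDerivAt_mul_matrix_exp_smul Ytilde A t
  have hderiv (t : ℝ) : deriv Y t = Y t * A := (hd t).deriv
  have hd2 (t : ℝ) : HasDerivAt (deriv Y) (Y t * A * A) t := by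
    have hcomm (s : ℝ) : Y s * A = Ytilde * A * exp (s • A) := by
      simp only [Y]
      rw [Matrix.mul_assoc, matrix_exp_smul_mul_comm, Matrix.mul_assoc]
    rw [funext hderiv]
    simp only [hcomm]
    exact hasDerivAt_mul_matrix_exp_smul (Ytilde * A) A t
  have hderiv2 (t : ℝ) : deriv (deriv Y) t = Y t * A * A := (hd2 t).deriv
  refine ⟨hYY, ⟨fun t => (hd t).differentiableAt, fun t => (hd2 t).differentiableAt, fun t => ?_⟩,
    hY0, by rw [hderiv, hY0]⟩
  have hvel : (Y t * A)ᵀ * (Y t * A) = -(A * A) := by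
    rw [transpose_mul, Matrix.mul_assoc, ← Matrix.mul_assoc (Y t)ᵀ, hYY, Matrix.one_mul,
      eq_neg_of_add_eq_zero_left hA, Matrix.neg_mul]
  have hproj : (1 - Y t * (Y t)ᵀ) * Y t = 0 := by
    rw [Matrix.sub_mul, Matrix.mul_assoc, hYY, Matrix.one_mul, Matrix.mul_one, sub_self]
  rw [hderiv2, hderiv, hvel, ← Matrix.mul_assoc _ (Y t * A), ← Matrix.mul_assoc _ (Y t),
    hproj]
  simp [Matrix.mul_assoc]
end

section
/- Let α ∈ ℝ, let Ỹ ∈ ℝ^{n×p} and Q ∈ ℝ^{n×k} satisfy ỸᵀỸ = I_p, QᵀQ = I_k, ỸᵀQ = 0, and let Z ∈ ℝ^{n×p} satisfy ZᵀZ = I_p. For an antisymmetric ΔA ∈ ℝ^{p×p} and ΔR ∈ ℝ^{k×p}, set ΔÂ := [[2αΔA, −ΔRᵀ],[ΔR, 0]] ∈ ℝ^{(p+k)×(p+k)}, P := [I_p; 0_{k×p}], and f(s) := −Tr( Zᵀ·[Ỹ Q]·exp(s·ΔÂ)·P·exp((1−2α)·s·ΔA) ). Then f is twice differentiable at s = 0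 and f''(0) = −Tr( ZᵀỸ·(ΔA² − ΔRᵀ·ΔR) ) − (2−2α)·Tr( ZᵀQ·ΔR·ΔA ). In particular, when Z = Ỹ, f''(0) = Tr(ΔRᵀΔR) − Tr(ΔA²) = ‖ΔR‖²_F + ‖ΔA‖²_F, so the Hessian of the objective at the zero tangent vector is the identity operator. -/
open Matrix NormedSpace

namespace Matrix

section Deriv

variable {l m n : Type*}

/-- Entrywise product rule for rectangular matrix products. -/
theorem hasDerivAt_mul_apply [Fintype m] {F : ℝ → Matrix l m ℝ} {G : ℝ → Matrix m n ℝ}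
    {F' : Matrix l m ℝ} {G' : Matrix m n ℝ} {t : ℝ}
    (hF : ∀ i j, HasDerivAt (fun s => F s i j) (F' i j) t)
    (hG : ∀ i j, HasDerivAt (fun s => G s i j) (G' i j) t) (i : l) (j : n) :
    HasDerivAt (fun s => (F s * G s) i j) ((F' * G t + F t * G') i j) t := by
  simp only [add_apply, mul_apply, ← Finset.sum_add_distrib]
  exact HasDerivAt.fun_sum fun x _ => (hF i x).mul (hG x j)

section Exp

attribute [local instance] Matrix.linftyOpNormedRing Matrix.linftyOpNormedAlgebra

theorem hasDerivAt_exp_smul_apply [Fintype m] [DecidableEq m] (M : Matrix m m ℝ) (t : ℝ)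
    (i j : m) :
    HasDerivAt (fun s : ℝ => exp (s • M) i j) ((exp (t • M) * M) i j) t :=
  ((entryLinearMap ℝ ℝ i j).toContinuousLinearMap.hasFDerivAt).comp_hasDerivAt t
    (hasDerivAt_exp_smul_const (𝕂 := ℝ) M t)

theorem hasDerivAt_exp_mul_smul_apply [Fintype m] [DecidableEq m] (M : Matrix m m ℝ)
    (b t : ℝ) (i j : m) :
    HasDerivAt (fun s : ℝ => exp ((b * s) • M) i j) ((b • (M * exp ((b * t) • M))) i j) t := by
  have h := (entryLinearMap ℝ ℝ i j).toContinuousLinearMap.hasFDerivAt.comp_hasDerivAt (b * t)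
    (hasDerivAt_exp_smul_const' (𝕂 := ℝ) M (b * t))
  have hb : HasDerivAt (fun s : ℝ => b * s) b t := by
    simpa using (hasDerivAt_id t).const_mul b
  exact h.scomp t hb

end Exp

/-- Differentiating `s ↦ Tr(C exp(sM) D exp(bsN))` replaces `D` by `MD + bDN`. -/
theorem hasDerivAt_trace_mul_exp_mul_exp [Fintype m] [DecidableEq m] [Fintype n]
    [DecidableEq n] (C : Matrix n m ℝ) (M : Matrix m m ℝ) (D : Matrix m n ℝ)
    (N : Matrix n n ℝ) (b t : ℝ) :
    HasDerivAt (fun s : ℝ => trace (C * exp (s • M) * D * exp ((b * s) • N)))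
      (trace (C * exp (t • M) * (M * D + b • (D * N)) * exp ((b * t) • N))) t := by
  have hC (i j) : HasDerivAt (fun _ : ℝ => C i j) ((0 : Matrix n m ℝ) i j) t :=
    hasDerivAt_const _ _
  have hD (i j) : HasDerivAt (fun _ : ℝ => D i j) ((0 : Matrix m n ℝ) i j) t :=
    hasDerivAt_const _ _
  have h := HasDerivAt.fun_sum (u := Finset.univ) fun i _ =>
    hasDerivAt_mul_apply (F := fun s => C * exp (s • M) * D)
      (hasDerivAt_mul_apply (F := fun s => C * exp (s • M)) (G := fun _ => D)
        (hasDerivAt_mul_apply (F := fun _ => C) hC (hasDerivAt_exp_smul_apply M t)) hD)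
      (hasDerivAt_exp_mul_smul_apply N b t) i i
  refine h.congr_deriv (congrArg trace ?_)
  simp [Matrix.mul_add, Matrix.add_mul, Matrix.mul_assoc]

end Deriv

end Matrix

/-- Second derivative at `0` of the Stiefel objective along the ray `(sΔA, sΔR)`:
for `f(s) = −Tr(Zᵀ[Ỹ Q]exp(sΔÂ)P exp((1−2α)sΔA))` one has
`f''(0) = −Tr(ZᵀỸ(ΔA² − ΔRᵀΔR)) − (2−2α)Tr(ZᵀQΔRΔA)`; in particular for `Z = Ỹ` it equals
`Tr(ΔRᵀΔR) − Tr(ΔA²) = ‖ΔR‖²_F + ‖ΔA‖²_F`, so the Hessian at the zero tangent vector is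
the identity. -/
theorem stiefel_objective_hessian_at_zero {n p k : ℕ} (α : ℝ)
    (Ytilde Z : Matrix (Fin n) (Fin p) ℝ) (Q : Matrix (Fin n) (Fin k) ℝ)
    (hY : Ytildeᵀ * Ytilde = 1) (hQ : Qᵀ * Q = 1) (hYQ : Ytildeᵀ * Q = 0)
    (hZ : Zᵀ * Z = 1)
    (ΔA : Matrix (Fin p) (Fin p) ℝ) (ΔR : Matrix (Fin k) (Fin p) ℝ)
    (hΔA : ΔAᵀ + ΔA = 0) :
    let hatΔ : Matrix (Fin p ⊕ Fin k) (Fin p ⊕ Fin k) ℝ :=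
      fromBlocks ((2 * α) • ΔA) (-ΔRᵀ) ΔR 0
    let P : Matrix (Fin p ⊕ Fin k) (Fin p) ℝ :=
      fromRows (1 : Matrix (Fin p) (Fin p) ℝ) (0 : Matrix (Fin k) (Fin p) ℝ)
    let K : Matrix (Fin n) (Fin p ⊕ Fin k) ℝ := fromCols Ytilde Q
    let f : ℝ → ℝ := fun s =>
      -Matrix.trace (Zᵀ * K * exp (s • hatΔ) * P * exp (((1 - 2 * α) * s) • ΔA))
    DifferentiableAt ℝ f 0 ∧ DifferentiableAt ℝ (deriv f) 0 ∧
    deriv (deriv f) 0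
      = -Matrix.trace (Zᵀ * Ytilde * (ΔA * ΔA - ΔRᵀ * ΔR))
        - (2 - 2 * α) * Matrix.trace (Zᵀ * Q * (ΔR * ΔA)) ∧
    (Z = Ytilde →
      deriv (deriv f) 0 = Matrix.trace (ΔRᵀ * ΔR) + Matrix.trace (ΔAᵀ * ΔA)) := by
  intro hatΔ P K f
  have hf (D : Matrix (Fin p ⊕ Fin k) (Fin p) ℝ) (t : ℝ) :=
    (hasDerivAt_trace_mul_exp_mul_exp (Zᵀ * K) hatΔ D ΔA (1 - 2 * α) t).neg
  have hderiv : deriv f = fun s => -trace (Zᵀ * K * exp (s • hatΔ) *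
      (hatΔ * P + (1 - 2 * α) • (P * ΔA)) * exp (((1 - 2 * α) * s) • ΔA)) :=
    funext fun t => (hf P t).deriv
  have hsecond := hf (hatΔ * P + (1 - 2 * α) • (P * ΔA)) 0
  have hD : hatΔ * (hatΔ * P + (1 - 2 * α) • (P * ΔA)) +
      (1 - 2 * α) • ((hatΔ * P + (1 - 2 * α) • (P * ΔA)) * ΔA) =
      fromRows (ΔA * ΔA - ΔRᵀ * ΔR) ((2 - 2 * α) • (ΔR * ΔA)) := by
    have h₁ : hatΔ * P + (1 - 2 * α) • (P * ΔA) = fromRows ΔA ΔR := by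
      simp only [hatΔ, P, fromBlocks_mul_fromRows, fromRows_mul]
      ext (i | i) j <;> simp
      ring
    rw [h₁]
    simp only [hatΔ, fromBlocks_mul_fromRows, fromRows_mul]
    ext (i | i) j <;> simp <;> ring
  have hvalue : deriv (deriv f) 0 = -trace (Zᵀ * Ytilde * (ΔA * ΔA - ΔRᵀ * ΔR))
      - (2 - 2 * α) * trace (Zᵀ * Q * (ΔR * ΔA)) := by
    rw [hderiv]
    refine hsecond.deriv.trans ?_
    rw [hD]
    simp only [zero_smul, mul_zero, exp_zero, Matrix.mul_one, K, Matrix.mul_assoc,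
      fromCols_mul_fromRows, Matrix.mul_add, trace_add, Matrix.mul_smul, trace_smul, smul_eq_mul]
    ring
  refine ⟨(hf P 0).differentiableAt, hderiv ▸ hsecond.differentiableAt, hvalue, ?_⟩
  rintro rfl
  rw [hvalue, hY, hYQ, eq_neg_of_add_eq_zero_left hΔA]
  simp [sub_eq_add_neg]
end

section
/- Let α ∈ ℝ, let Ỹ ∈ ℝ^{n×m} and Q ∈ ℝ^{n×k} satisfy ỸᵀỸ = I_m, QᵀQ = I_k, ỸᵀQ = 0, and let Λ ∈ ℝ^{m×m} be diagonal. For an antisymmetric ΔA ∈ ℝ^{m×m} and ΔR ∈ ℝ^{k×m}, set ΔÂ := [[2αΔA, −ΔRᵀ],[ΔR, 0]], P := [I_m; 0_{k×m}], Y_s := [Ỹ Q]·exp(s·ΔÂ)·P·exp((1−2α)·s·ΔA), and f(s) := −Tr( Ỹᵀ·Y_s·Λ·Y_sᵀ·Ỹ·Λ ). Then f is twice differentiable at s = 0 and f''(0) = 2·Tr( ΔRᵀ·ΔR·Λ² − ΔAᵀ·Λ·ΔA·Λ + ΔAᵀ·ΔA·Λ² ). -/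
open Matrix NormedSpace

section NormedAlgebra

variable {𝔸 𝔹 : Type*} [NormedRing 𝔸] [NormedAlgebra ℝ 𝔸] [CompleteSpace 𝔸]
  [NormedRing 𝔹] [NormedAlgebra ℝ 𝔹] [CompleteSpace 𝔹]

/-- The curve `s ↦ L (exp (s • H) * C) * (exp (s • D) * E)` is differentiable, and its derivative
is a sum of two curves of the same shape. -/
theorem hasDerivAt_map_exp_smul_mul_exp_smul (L : 𝔸 →L[ℝ] 𝔹) (H C : 𝔸) (D E : 𝔹) (s : ℝ) :
    HasDerivAt (fun s : ℝ => L (exp (s • H) * C) * (exp (s • D) * E))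
      (L (exp (s • H) * (H * C)) * (exp (s • D) * E) +
        L (exp (s • H) * C) * (exp (s • D) * (D * E))) s := by
  have hL := L.hasFDerivAt.comp_hasDerivAt s
    ((hasDerivAt_exp_smul_const (𝕂 := ℝ) H s).mul_const C)
  simpa only [Function.comp_def, mul_assoc] using
    hL.fun_mul ((hasDerivAt_exp_smul_const (𝕂 := ℝ) D s).mul_const E)

/-- First and second derivatives at `0` of a quadratic form evaluated along the curve
`s ↦ L (exp (s • H)) * exp (s • D)`. -/
theorem quadratic_map_exp_smul_mul_exp_smul_deriv_deriv (b : 𝔹 →L[ℝ] 𝔹 →L[ℝ] ℝ)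
    (L : 𝔸 →L[ℝ] 𝔹) (H : 𝔸) (D : 𝔹) (f : ℝ → ℝ)
    (hf : ∀ s, f s = b (L (exp (s • H)) * exp (s • D)) (L (exp (s • H)) * exp (s • D)))
    {X₀ X₁ X₂ : 𝔹}
    (h₀ : L 1 = X₀) (h₁ : L H + L 1 * D = X₁)
    (h₂ : L (H * H) + 2 • (L H * D) + L 1 * (D * D) = X₂) :
    DifferentiableAt ℝ f 0 ∧ DifferentiableAt ℝ (deriv f) 0 ∧
    deriv (deriv f) 0 = b X₀ X₂ + 2 * b X₁ X₁ + b X₂ X₀ := by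
  subst h₀ h₁ h₂
  let c (C : 𝔸) (E : 𝔹) (s : ℝ) : 𝔹 := L (exp (s • H) * C) * (exp (s • D) * E)
  have hc (C E s) : HasDerivAt (c C E) (c (H * C) E s + c C (D * E) s) s :=
    hasDerivAt_map_exp_smul_mul_exp_smul L H C D E s
  have hc0 (C E) : c C E 0 = L C * E := by simp [c]
  have hb {u v : ℝ → 𝔹} {u' v' : 𝔹} {s : ℝ} (hu : HasDerivAt u u' s) (hv : HasDerivAt v v' s) :
      HasDerivAt (fun t => b (u t) (v t)) (b (u s) v' + b u' (v s)) s :=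
    b.hasDerivAt_of_bilinear (fun _ => hu) (fun _ => hv)
  have hf' : f = fun s => b (c 1 1 s) (c 1 1 s) := by
    funext s
    simp [hf, c]
  let g (s : ℝ) : 𝔹 := c (H * 1) 1 s + c 1 (D * 1) s
  have hfd (s) : HasDerivAt f (b (c 1 1 s) (g s) + b (g s) (c 1 1 s)) s :=
    hf' ▸ hb (hc 1 1 s) (hc 1 1 s)
  have hg := (hc (H * 1) 1 0).fun_add (hc 1 (D * 1) 0)
  have hdd := (hb (hc 1 1 0) hg).fun_add (hb hg (hc 1 1 0))
  have hderiv : deriv f = fun s => b (c 1 1 s) (g s) + b (g s) (c 1 1 s) :=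
    funext fun s => (hfd s).deriv
  refine ⟨(hfd 0).differentiableAt, ?_, ?_⟩
  · rw [hderiv]
    exact hdd.differentiableAt
  · rw [hderiv, HasDerivAt.deriv hdd]
    simp only [hc0, mul_one, map_add, _root_.add_apply, two_nsmul]
    ring

end NormedAlgebra

/-- The bilinear form `(X, W) ↦ -Tr(X Λ Wᵀ Λ)` on square matrices. -/
def negTraceForm {ι : Type*} [Fintype ι] (Λ : Matrix ι ι ℝ) :
    Matrix ι ι ℝ →ₗ[ℝ] Matrix ι ι ℝ →ₗ[ℝ] ℝ :=
  LinearMap.mk₂ ℝ (fun X W => -trace (X * Λ * Wᵀ * Λ))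
    (fun X X' W => by simp [Matrix.add_mul, add_comm])
    (fun c X W => by simp)
    (fun X W W' => by simp [Matrix.add_mul, Matrix.mul_add, add_comm])
    (fun c X W => by simp)

/-- The upper left block of a block matrix, as a linear map. -/
def upperLeftBlock (ι κ : Type*) :
    Matrix (ι ⊕ κ) (ι ⊕ κ) ℝ →ₗ[ℝ] Matrix ι ι ℝ where
  toFun := toBlocks₁₁
  map_add' _ _ := rfl
  map_smul' _ _ := rfl

@[simp]
theorem upperLeftBlock_fromBlocks {ι κ : Type*} (A : Matrix ι ι ℝ) (B : Matrix ι κ ℝ)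
    (C : Matrix κ ι ℝ) (D : Matrix κ κ ℝ) :
    upperLeftBlock ι κ (fromBlocks A B C D) = A :=
  rfl

/-- If `YᵀY = 1` and `YᵀQ = 0`, then `Yᵀ [Y Q] M [1; 0]` is the upper left block of `M`. -/
theorem transpose_mul_fromCols_mul_mul_fromRows {n ι κ : Type*} [Fintype n] [Fintype ι]
    [Fintype κ] [DecidableEq ι] (Y : Matrix n ι ℝ) (Q : Matrix n κ ℝ)
    (hY : Yᵀ * Y = 1) (hYQ : Yᵀ * Q = 0) (M : Matrix (ι ⊕ κ) (ι ⊕ κ) ℝ) :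
    Yᵀ * (fromCols Y Q * M * fromRows (1 : Matrix ι ι ℝ) (0 : Matrix κ ι ℝ)) =
      upperLeftBlock ι κ M := by
  rw [← Matrix.mul_assoc, ← Matrix.mul_assoc, mul_fromCols, hY, hYQ, ← fromBlocks_toBlocks M,
    fromCols_mul_fromBlocks, fromCols_mul_fromRows]
  simp

/-- Second derivative at `0` of the flag-manifold objective with target `Z = Ỹ` along the ray
`(sΔA, sΔR)`: with `Y_s = [Ỹ Q]exp(sΔÂ)P exp((1−2α)sΔA)` and
`f(s) = −Tr(ỸᵀY_s Λ Y_sᵀ Ỹ Λ)`, one has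
`f''(0) = 2 Tr(ΔRᵀΔRΛ² − ΔAᵀΛΔAΛ + ΔAᵀΔAΛ²)`. -/
theorem flag_objective_hessian_at_zero {n m k : ℕ} (α : ℝ)
    (Ytilde : Matrix (Fin n) (Fin m) ℝ) (Q : Matrix (Fin n) (Fin k) ℝ)
    (hY : Ytildeᵀ * Ytilde = 1) (hQ : Qᵀ * Q = 1) (hYQ : Ytildeᵀ * Q = 0)
    (lam : Fin m → ℝ)
    (ΔA : Matrix (Fin m) (Fin m) ℝ) (ΔR : Matrix (Fin k) (Fin m) ℝ)
    (hΔA : ΔAᵀ + ΔA = 0) :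
    let Λ : Matrix (Fin m) (Fin m) ℝ := Matrix.diagonal lam
    let hatΔ : Matrix (Fin m ⊕ Fin k) (Fin m ⊕ Fin k) ℝ :=
      fromBlocks ((2 * α) • ΔA) (-ΔRᵀ) ΔR 0
    let P : Matrix (Fin m ⊕ Fin k) (Fin m) ℝ :=
      fromRows (1 : Matrix (Fin m) (Fin m) ℝ) (0 : Matrix (Fin k) (Fin m) ℝ)
    let K : Matrix (Fin n) (Fin m ⊕ Fin k) ℝ := fromCols Ytilde Q
    let Ys : ℝ → Matrix (Fin n) (Fin m) ℝ := fun s =>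
      K * exp (s • hatΔ) * P * exp (((1 - 2 * α) * s) • ΔA)
    let f : ℝ → ℝ := fun s => -Matrix.trace (Ytildeᵀ * Ys s * Λ * (Ys s)ᵀ * Ytilde * Λ)
    DifferentiableAt ℝ f 0 ∧ DifferentiableAt ℝ (deriv f) 0 ∧
    deriv (deriv f) 0
      = 2 * Matrix.trace (ΔRᵀ * ΔR * (Λ * Λ) - ΔAᵀ * Λ * ΔA * Λ + ΔAᵀ * ΔA * (Λ * Λ)) := by
  intro Λ hatΔ P K Ys f
  have hf (s : ℝ) : f s = negTraceForm Λ
      (upperLeftBlock (Fin m) (Fin k) (exp (s • hatΔ)) * exp (s • ((1 - 2 * α) • ΔA)))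
      (upperLeftBlock (Fin m) (Fin k) (exp (s • hatΔ)) * exp (s • ((1 - 2 * α) • ΔA))) := by
    have hX : Ytildeᵀ * Ys s =
        upperLeftBlock (Fin m) (Fin k) (exp (s • hatΔ)) * exp (s • ((1 - 2 * α) • ΔA)) := by
      rw [← transpose_mul_fromCols_mul_mul_fromRows Ytilde Q hY hYQ, smul_smul, mul_comm s,
        Matrix.mul_assoc Ytildeᵀ]
    have hXt : (Ys s)ᵀ * Ytilde = (Ytildeᵀ * Ys s)ᵀ := by
      rw [transpose_mul Ytildeᵀ, transpose_transpose]
    simp only [f, negTraceForm, LinearMap.mk₂_apply, ← hX, ← hXt, Matrix.mul_assoc]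
  have hA : ΔAᵀ = -ΔA := eq_neg_of_add_eq_zero_left hΔA
  have hL1 : upperLeftBlock (Fin m) (Fin k) 1 = 1 := by
    rw [← fromBlocks_one, upperLeftBlock_fromBlocks]
  have hLH : upperLeftBlock (Fin m) (Fin k) hatΔ = (2 * α) • ΔA := rfl
  have hLHH : upperLeftBlock (Fin m) (Fin k) (hatΔ * hatΔ) =
      (2 * α) ^ 2 • (ΔA * ΔA) - ΔRᵀ * ΔR := by
    simp [hatΔ, fromBlocks_multiply, smul_smul, pow_two, sub_eq_add_neg]
  have hX' : upperLeftBlock (Fin m) (Fin k) hatΔ +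
      upperLeftBlock (Fin m) (Fin k) 1 * ((1 - 2 * α) • ΔA) = ΔA := by
    rw [hLH, hL1, one_mul]
    module
  have hX'' : upperLeftBlock (Fin m) (Fin k) (hatΔ * hatΔ) +
      2 • (upperLeftBlock (Fin m) (Fin k) hatΔ * ((1 - 2 * α) • ΔA)) +
      upperLeftBlock (Fin m) (Fin k) 1 * (((1 - 2 * α) • ΔA) * ((1 - 2 * α) • ΔA)) =
      ΔA * ΔA - ΔRᵀ * ΔR := by
    rw [hLHH, hLH, hL1, one_mul]
    simp only [smul_mul_assoc, mul_smul_comm]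
    module
  have hS : (ΔA * ΔA - ΔRᵀ * ΔR)ᵀ = ΔA * ΔA - ΔRᵀ * ΔR := by
    simp [hA]
  open scoped Matrix.Norms.Operator in
  obtain ⟨h₁, h₂, h₃⟩ := quadratic_map_exp_smul_mul_exp_smul_deriv_deriv
    (negTraceForm Λ).toContinuousBilinearMap
    (upperLeftBlock (Fin m) (Fin k)).toContinuousLinearMap hatΔ ((1 - 2 * α) • ΔA) f hf
    hL1 hX' hX''
  refine ⟨h₁, h₂, h₃.trans ?_⟩
  change negTraceForm Λ 1 (ΔA * ΔA - ΔRᵀ * ΔR) + 2 * negTraceForm Λ ΔA ΔA +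
    negTraceForm Λ (ΔA * ΔA - ΔRᵀ * ΔR) 1 = _
  simp only [negTraceForm, LinearMap.mk₂_apply, hS, transpose_one, one_mul, mul_one]
  rw [Matrix.mul_assoc Λ, trace_mul_comm Λ, hA]
  simp only [Matrix.sub_mul, Matrix.mul_assoc, Matrix.neg_mul, Matrix.mul_neg, trace_sub,
    trace_add, trace_neg]
  ring
end
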